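/- Suppose X₁,…,X_m are η-coplanar. Then for every unit vector θ in the interior of the cone C_X, γ(θ) = ⟨θ, η⟩·log Z(t) − ⟨t, θ⟩, where t is any solution of the equation ∇Z(t)/Z(t) = θ/⟨θ, η⟩. -/

import Mathlib

open scoped BigOperators RealInnerProductSpace
open Filter Topology

noncomputable section

/-- `Euc s` is the Euclidean space `ℝ^s`. -/
abbrev Euc (s : ℕ) := EuclideanSpace ℝ (Fin s)

/-- The additive semigroup `X₁ℕ + ⋯ + X_mℕ` generated by the vectors `X j`. -/
def sgOf {s : ℕ} {ι : Type*} [Fintype ι] (X : ι → Euc s) : Set (Euc s) :=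
  {z | ∃ u : ι → ℕ, ∑ j, (u j : ℝ) • X j = z}

/-- The lattice `X₁ℤ + ⋯ + X_mℤ` generated by the vectors `X j`. -/
def latOf {s : ℕ} {ι : Type*} [Fintype ι] (X : ι → Euc s) : Set (Euc s) :=
  {z | ∃ u : ι → ℤ, ∑ j, (u j : ℝ) • X j = z}

/-- The convex cone `X₁ℝ⁺ + ⋯ + X_mℝ⁺` generated by the vectors `X j`. -/
def coneOf {s : ℕ} {ι : Type*} [Fintype ι] (X : ι → Euc s) : Set (Euc s) :=
  {x | ∃ c : ι → ℝ, (∀ j, 0 ≤ c j) ∧ ∑ j, c j • X j = x}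

/-- The multiplicity of `z`: the number of finite words `i₁…i_n` with
`X_{i₁} + ⋯ + X_{i_n} = z`. -/
def mult {s : ℕ} {ι : Type*} [Fintype ι] (X : ι → Euc s) (z : Euc s) : ℕ :=
  Set.ncard {w : List ι | (w.map X).sum = z}

/-- The multiplicity extended to the cone: the minimum of `mult X z` over points
`z` of the semigroup nearest to `x`. -/
def multC {s : ℕ} {ι : Type*} [Fintype ι] (X : ι → Euc s) (x : Euc s) : ℕ :=
  sInf {n | ∃ z ∈ sgOf X, dist x z = Metric.infDist x (sgOf X) ∧ mult X z = n}

/-- All the vectors `X j` have integer coordinates. -/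
def IntegralVecs {s : ℕ} {ι : Type*} (X : ι → Euc s) : Prop :=
  ∀ j i, ∃ n : ℤ, X j i = (n : ℝ)

/-- The entropy `h(p) = -∑ p_j log p_j` of a probability vector. -/
def entropy {m : ℕ} (p : Fin m → ℝ) : ℝ := -∑ j, p j * Real.log (p j)

/-- The `p`-th iteration of `X`: all sums `X_{ω₁} + ⋯ + X_{ω_p}` over words `ω`. -/
def iter {s m : ℕ} (X : Fin m → Euc s) (p : ℕ) : (Fin p → Fin m) → Euc s :=
  fun ω => ∑ i, X (ω i)

/-- Words with prescribed letter counts. -/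
def cntWords {m : ℕ} (u : Fin m → ℕ) : Set (List (Fin m)) := {w | ∀ j, w.count j = u j}

lemma length_eq_sum_count {m : ℕ} (w : List (Fin m)) : w.length = ∑ j, w.count j := by
  have h := Multiset.sum_count_eq_card (s := Finset.univ) (m := (w : Multiset (Fin m))) (by simp)
  simpa using h.symm

lemma cntWords_finite {m : ℕ} (u : Fin m → ℕ) : (cntWords u).Finite := by
  refine (List.finite_length_eq (Fin m) (∑ j, u j)).subset ?_
  intro w hw
  simp only [Set.mem_ofPred_eq, length_eq_sum_count]
  exact Finset.sum_congr rfl fun j _ => hw j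

lemma cntWords_card {m : ℕ} (n : ℕ) : ∀ u : Fin m → ℕ, ∑ j, u j = n →
    n.factorial ≤ (cntWords u).ncard * ∏ j, (u j).factorial := by
  induction n with
  | zero =>
    intro u hu
    have h0 : ∀ j, u j = 0 := by simpa using hu
    have : ([] : List (Fin m)) ∈ cntWords u := by intro j; simp [h0]
    have h1 : 0 < (cntWords u).ncard := (Set.ncard_pos (cntWords_finite u)).2 ⟨_, this⟩
    simp [h0]; omega
  | succ n ih =>
    intro u hu
    classical
    let v : Fin m → Fin m → ℕ := fun j => Function.update u j (u j - 1)
    let P := Finset.univ.filter fun j => 0 < u j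
    let F : Fin m → Finset (List (Fin m)) := fun j =>
      (cntWords_finite (v j)).toFinset.image (List.cons j)
    have hsub : P.biUnion F ⊆ (cntWords_finite u).toFinset := by
      intro w hw
      simp only [P, F, Finset.mem_biUnion, Finset.mem_filter, Finset.mem_univ, true_and,
        Finset.mem_image, Set.Finite.mem_toFinset] at hw ⊢
      obtain ⟨j, hj, w', hw', rfl⟩ := hw
      intro i
      have := hw' i
      simp only [v, Function.update_apply] at this
      rw [List.count_cons, this]
      by_cases hij : i = j
      · subst hij; simp; omega
      · simp [hij, Ne.symm hij]
    have hcard : ∑ j ∈ P, (cntWords (v j)).ncard ≤ (cntWords u).ncard := by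
      rw [Set.ncard_eq_toFinset_card _ (cntWords_finite u)]
      refine le_trans (le_of_eq ?_) (Finset.card_le_card hsub)
      rw [Finset.card_biUnion]
      · refine Finset.sum_congr rfl fun j _ => ?_
        rw [Finset.card_image_of_injective _ (List.cons_injective), Set.ncard_eq_toFinset_card _ (cntWords_finite _)]
      · intro i _ j _ hij
        rw [Function.onFun, Finset.disjoint_left]
        intro w h1 h2
        simp only [F, Finset.mem_image] at h1 h2
        obtain ⟨a, -, rfl⟩ := h1
        obtain ⟨b, -, hb⟩ := h2
        exact hij (List.cons.inj hb).1.symm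
    have hterm : ∀ j ∈ P, u j * n.factorial ≤ (cntWords (v j)).ncard * ∏ i, (u i).factorial := by
      intro j hj
      have hj : 0 < u j := by simpa [P] using hj
      have e1 : ∑ i, v j i = n := by
        have := Finset.sum_update_of_mem (Finset.mem_univ j) u (u j - 1)
        have h2 := Finset.add_sum_erase Finset.univ u (Finset.mem_univ j)
        simp only [v]
        rw [this, Finset.sdiff_singleton_eq_erase]
        omega
      have e2 : ∏ i, (u i).factorial = u j * ∏ i, (v j i).factorial := by
        rw [← Finset.mul_prod_erase _ _ (Finset.mem_univ j),
          ← Finset.mul_prod_erase Finset.univ (fun i => (v j i).factorial) (Finset.mem_univ j), ← mul_assoc]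
        congr 1
        · simp only [v, Function.update_self]
          exact (Nat.mul_factorial_pred hj.ne').symm
        · refine Finset.prod_congr rfl fun i hi => ?_
          simp only [v, Function.update_of_ne (Finset.ne_of_mem_erase hi)]
      have := ih (v j) e1
      rw [e2]
      calc u j * n.factorial ≤ u j * ((cntWords (v j)).ncard * ∏ i, (v j i).factorial) := by gcongr
        _ = _ := by ring
    have hP : ∑ j ∈ P, u j = n + 1 := by
      rw [← hu]
      refine Finset.sum_subset (Finset.filter_subset _ _) fun j _ hj => ?_
      simpa [P] using hj
    calc (n+1).factorial = (∑ j ∈ P, u j) * n.factorial := by rw [hP, Nat.factorial_succ]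
      _ = ∑ j ∈ P, u j * n.factorial := Finset.sum_mul ..
      _ ≤ ∑ j ∈ P, (cntWords (v j)).ncard * ∏ i, (u i).factorial := Finset.sum_le_sum hterm
      _ = (∑ j ∈ P, (cntWords (v j)).ncard) * ∏ i, (u i).factorial := (Finset.sum_mul ..).symm
      _ ≤ _ := by gcongr

lemma sum_map_count {s m : ℕ} (X : Fin m → Euc s) (w : List (Fin m)) :
    (w.map X).sum = ∑ j, (w.count j : ℝ) • X j := by
  rw [Finset.sum_list_map_count]
  refine (Finset.sum_subset (Finset.subset_univ _) ?_).trans ?_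
  · intro j _ hj
    rw [List.mem_toFinset] at hj
    simp [List.count_eq_zero_of_not_mem hj]
  · simp [Nat.cast_smul_eq_nsmul]

lemma word_length {s m : ℕ} (X : Fin m → Euc s) (η : Euc s) (hη : ∀ j, ⟪η, X j⟫ = 1)
    (w : List (Fin m)) : (w.length : ℝ) = ⟪η, (w.map X).sum⟫ := by
  rw [sum_map_count, inner_sum, length_eq_sum_count]
  simp [inner_smul_right, hη]

lemma words_finite {s m : ℕ} (X : Fin m → Euc s) (η : Euc s) (hη : ∀ j, ⟪η, X j⟫ = 1)
    (z : Euc s) (n : ℕ) (hn : ⟪η, z⟫ = n) :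
    ∀ w ∈ {w : List (Fin m) | (w.map X).sum = z}, w.length = n := by
  intro w hw
  have := word_length X η hη w
  rw [hw, hn] at this
  exact_mod_cast this

lemma mult_lower {s m : ℕ} (X : Fin m → Euc s) (η : Euc s) (hη : ∀ j, ⟪η, X j⟫ = 1)
    (u : Fin m → ℕ) (z : Euc s) (hz : ∑ j, (u j : ℝ) • X j = z) :
    (∑ j, u j).factorial ≤ mult X z * ∏ j, (u j).factorial := by
  refine (cntWords_card _ u rfl).trans ?_
  gcongr
  refine Set.ncard_le_ncard ?_ ?_
  · intro w hw
    simp only [Set.mem_ofPred_eq]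
    rw [sum_map_count, ← hz]
    exact Finset.sum_congr rfl fun j _ => by rw [hw j]
  · refine (List.finite_length_eq (Fin m) (∑ j, u j)).subset (words_finite X η hη z _ ?_)
    rw [← hz, inner_sum]
    simp [inner_smul_right, hη]

lemma mult_upper {s m : ℕ} (X : Fin m → Euc s) (η : Euc s) (hη : ∀ j, ⟪η, X j⟫ = 1)
    (z t : Euc s) (n : ℕ) (hn : ⟪η, z⟫ = n) :
    (mult X z : ℝ) * Real.exp ⟪t, z⟫ ≤ (∑ j, Real.exp ⟪t, X j⟫) ^ n := by
  classical
  let F := Finset.univ.filter fun f : Fin n → Fin m => ∑ i, X (f i) = z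
  have h1 : mult X z ≤ F.card := by
    rw [← Set.ncard_coe_finset]
    refine le_trans (Set.ncard_le_ncard ?_ (F.finite_toSet.image List.ofFn))
      (Set.ncard_image_le F.finite_toSet)
    intro w hw
    have hl := words_finite X η hη z n hn w hw
    subst hl
    refine ⟨w.get, ?_, List.ofFn_get w⟩
    simp only [F, Finset.coe_filter, Finset.mem_univ, true_and]
    change ∑ i, X (w.get i) = z
    rw [← (show (w.map X).sum = z from hw), ← List.sum_ofFn]
    congr 1
    conv_rhs => rw [← List.ofFn_get w]
    rw [List.map_ofFn]
    rfl
  rw [← Finset.card_univ.trans (Fintype.card_fin n), ← Finset.prod_const, Finset.prod_univ_sum]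
  calc (mult X z : ℝ) * Real.exp ⟪t, z⟫ ≤ F.card * Real.exp ⟪t, z⟫ := by gcongr
    _ = ∑ f ∈ F, ∏ i, Real.exp ⟪t, X (f i)⟫ := by
      rw [← nsmul_eq_mul, ← Finset.sum_const]
      refine Finset.sum_congr rfl fun f hf => ?_
      rw [← Real.exp_sum, ← inner_sum, (Finset.mem_filter.1 hf).2]
    _ ≤ _ := by
      rw [Fintype.piFinset_univ]
      exact Finset.sum_le_sum_of_subset_of_nonneg (Finset.subset_univ _) (fun f _ _ => by positivity)

lemma log_fact_limit (n : ℕ → ℕ) (x : ℝ) (hx : 0 < x)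
    (hn : Tendsto (fun k : ℕ => (n k : ℝ) / k) atTop (𝓝 x)) :
    Tendsto (fun k : ℕ => (Real.log ((n k).factorial : ℝ) - n k * Real.log k) / k) atTop
      (𝓝 (x * Real.log x - x)) := by
  have hninf : Tendsto n atTop atTop := by
    rw [← tendsto_natCast_atTop_iff (R := ℝ)]
    have := hn.pos_mul_atTop hx (tendsto_natCast_atTop_atTop (R := ℝ))
    refine this.congr' ?_
    filter_upwards [eventually_gt_atTop 0] with k hk
    field_simp
  have hloginv : Tendsto (fun j : ℕ => Real.log j / j) atTop (𝓝 0) :=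
    (Real.isLittleO_log_id_atTop.tendsto_div_nhds_zero).comp (tendsto_natCast_atTop_atTop (R := ℝ))
  have hinv : Tendsto (fun j : ℕ => 1 / (j : ℝ)) atTop (𝓝 0) := tendsto_one_div_atTop_nhds_zero_nat
  have hst : Tendsto (fun j : ℕ => Real.log (Stirling.stirlingSeq j)) atTop (𝓝 (Real.log (√Real.pi))) :=
    Stirling.tendsto_stirlingSeq_sqrt_pi.log (by positivity)
  have h1 : Tendsto (fun j : ℕ => Real.log (j.factorial : ℝ) / j - Real.log j) atTop (𝓝 (-1)) := by
    have h := ((hst.mul hinv).add ((hinv.const_mul (1/2 * Real.log 2)).add (hloginv.const_mul (1/2)))).add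
      (tendsto_const_nhds (x := (-1:ℝ)))
    simp only [mul_zero, add_zero, zero_add] at h
    refine h.congr' ?_
    filter_upwards [eventually_gt_atTop 0] with j hj
    have hj' : (j : ℝ) ≠ 0 := by positivity
    rw [Stirling.log_stirlingSeq_formula, Real.log_div hj' (by positivity), Real.log_mul (by norm_num) hj', Real.log_exp]
    field_simp
    ring
  have h2 := (hn.mul (h1.comp hninf)).add (hn.mul (hn.log hx.ne'))
  have e : x * -1 + x * Real.log x = x * Real.log x - x := by ring
  rw [e] at h2
  refine h2.congr' ?_
  filter_upwards [eventually_gt_atTop 0, hninf.eventually_gt_atTop 0] with k hk hnk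
  have hk' : (k : ℝ) ≠ 0 := by positivity
  have hnk' : (n k : ℝ) ≠ 0 := by positivity
  simp only [Function.comp]
  rw [Real.log_div hnk' hk']
  field_simp
  ring

lemma int_ball_finite {s : ℕ} (R : ℝ) :
    {z : Euc s | (∀ i, ∃ n : ℤ, z i = (n : ℝ)) ∧ ‖z‖ ≤ R}.Finite := by
  let B : ℤ := ⌈R⌉
  refine ((Set.finite_Icc (fun _ : Fin s => -B) (fun _ => B)).image
    (fun n : Fin s → ℤ => (WithLp.toLp 2 (fun i => (n i : ℝ)) : Euc s))).subset ?_
  rintro z ⟨hz, hR⟩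
  choose n hn using hz
  refine ⟨n, ?_, ?_⟩
  · have key : ∀ i, |(n i : ℝ)| ≤ B := fun i => by
      rw [← hn i]
      exact ((PiLp.norm_apply_le z i).trans hR).trans (Int.le_ceil R)
    constructor <;> intro i
    · have := (abs_le.1 (key i)).1
      exact_mod_cast this
    · have := (abs_le.1 (key i)).2
      exact_mod_cast this
  · ext i
    simp [hn i]

lemma lat_integral {s m : ℕ} (X : Fin m → Euc s) (hint : IntegralVecs X) (z : Euc s)
    (hz : z ∈ latOf X) : ∀ i, ∃ n : ℤ, z i = (n : ℝ) := by
  obtain ⟨u, rfl⟩ := hz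
  choose N hN using hint
  intro i
  refine ⟨∑ j, u j * N j i, ?_⟩
  simp [hN]

lemma sg_sub_lat {s m : ℕ} (X : Fin m → Euc s) : sgOf X ⊆ latOf X := by
  rintro z ⟨u, rfl⟩
  exact ⟨fun j => u j, by simp⟩

lemma bounded_coeffs {s m : ℕ} (X : Fin m → Euc s) (hint : IntegralVecs X) (R : ℝ) :
    ∃ M : ℝ, ∀ z ∈ latOf X, ‖z‖ ≤ R →
      ∃ d : Fin m → ℤ, ∑ j, (d j : ℝ) • X j = z ∧ ∀ j, |(d j : ℝ)| ≤ M := by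
  classical
  have hfin : {z : Euc s | z ∈ latOf X ∧ ‖z‖ ≤ R}.Finite :=
    (int_ball_finite R).subset fun z hz => ⟨lat_integral X hint z hz.1, hz.2⟩
  have : ∀ z : Euc s, ∃ d : Fin m → ℤ, z ∈ latOf X → ∑ j, (d j : ℝ) • X j = z := by
    intro z
    by_cases h : z ∈ latOf X
    · obtain ⟨d, hd⟩ := h
      exact ⟨d, fun _ => hd⟩
    · exact ⟨0, fun h' => absurd h' h⟩
  choose d hd using this
  refine ⟨∑ z ∈ hfin.toFinset, ∑ j, |(d z j : ℝ)|, fun z hz hR => ⟨d z, hd z hz, fun j => ?_⟩⟩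
  refine le_trans (Finset.single_le_sum (f := fun j => |(d z j : ℝ)|) (fun _ _ => abs_nonneg _)
    (Finset.mem_univ j)) ?_
  exact Finset.single_le_sum (f := fun z => ∑ j, |(d z j : ℝ)|)
    (fun _ _ => Finset.sum_nonneg fun _ _ => abs_nonneg _) (by simp [hz, hR])

lemma exists_nearest {s m : ℕ} (X : Fin m → Euc s) (hint : IntegralVecs X) (x : Euc s) :
    ∃ z ∈ sgOf X, dist x z = Metric.infDist x (sgOf X) := by
  have h0 : (0 : Euc s) ∈ sgOf X := ⟨0, by simp⟩
  have hfin : {z : Euc s | z ∈ sgOf X ∧ dist x z ≤ dist x 0}.Finite := by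
    refine (int_ball_finite (dist x 0 + ‖x‖)).subset fun z hz =>
      ⟨lat_integral X hint z (sg_sub_lat X hz.1), ?_⟩
    have h1 : ‖z‖ ≤ ‖x - z‖ + ‖x‖ := by
      have := norm_sub_le x (x - z)
      rw [sub_sub_cancel] at this
      linarith
    rw [← dist_eq_norm] at h1
    linarith [hz.2]
  obtain ⟨z, hz, hmin⟩ := Set.exists_min_image _ (fun z => dist x z) hfin ⟨0, h0, le_rfl⟩
  refine ⟨z, hz.1, le_antisymm ?_ (Metric.infDist_le_dist_of_mem hz.1)⟩
  rw [Metric.le_infDist ⟨0, h0⟩]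
  intro y hy
  by_cases h : dist x y ≤ dist x 0
  · exact hmin y ⟨hy, h⟩
  · exact (hz.2).trans (not_le.1 h).le

lemma approx {s m : ℕ} (X : Fin m → Euc s) (hint : IntegralVecs X) (a : Fin m → ℝ)
    (ha : ∀ j, 0 < a j) (θ : Euc s) (hθ : ∑ j, a j • X j = θ) :
    ∃ M : ℝ, ∀ k : ℕ, ∃ d : Fin m → ℤ,
      mult X (∑ j, (d j : ℝ) • X j) = multC X ((k : ℝ) • θ) ∧
      ∀ j, |(d j : ℝ) - k * a j| ≤ M := by
  let B := ∑ j, ‖X j‖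
  obtain ⟨M, hM⟩ := bounded_coeffs X hint (2 * B)
  refine ⟨M + 1, fun k => ?_⟩
  let W : Euc s := ∑ j, ((⌊k * a j⌋₊ : ℕ) : ℝ) • X j
  have hW : W ∈ sgOf X := ⟨_, rfl⟩
  have hfl : ∀ j, |((⌊k * a j⌋₊ : ℕ) : ℝ) - k * a j| ≤ 1 := fun j => by
    have h1 := Nat.floor_le (a := k * a j) (mul_nonneg (Nat.cast_nonneg k) (ha j).le)
    have h2 := Nat.lt_floor_add_one (k * a j)
    rw [abs_le]; constructor <;> linarith
  have hWd : dist ((k : ℝ) • θ) W ≤ B := by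
    rw [dist_comm, dist_eq_norm, ← hθ, Finset.smul_sum, ← Finset.sum_sub_distrib]
    refine (norm_sum_le _ _).trans (Finset.sum_le_sum fun j _ => ?_)
    rw [smul_smul, ← sub_smul, norm_smul, Real.norm_eq_abs]
    exact mul_le_of_le_one_left (norm_nonneg _) (hfl j)
  obtain ⟨z, hz, hzd, hzm⟩ : multC X ((k : ℝ) • θ) ∈ {n | ∃ z ∈ sgOf X,
      dist ((k : ℝ) • θ) z = Metric.infDist ((k : ℝ) • θ) (sgOf X) ∧ mult X z = n} := by
    refine Nat.sInf_mem ?_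
    obtain ⟨z, h1, h2⟩ := exists_nearest X hint ((k : ℝ) • θ)
    exact ⟨_, z, h1, h2, rfl⟩
  have hzW : ‖z - W‖ ≤ 2 * B := by
    rw [← dist_eq_norm]
    have h1 := dist_triangle_left z W ((k : ℝ) • θ)
    have h2 := Metric.infDist_le_dist_of_mem (x := (k : ℝ) • θ) hW
    linarith
  have hlat : z - W ∈ latOf X := by
    obtain ⟨u, rfl⟩ := hz
    refine ⟨fun j => (u j : ℤ) - (⌊k * a j⌋₊ : ℕ), ?_⟩
    simp [W, sub_smul, Finset.sum_sub_distrib]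
  obtain ⟨d, hd, hdM⟩ := hM _ hlat hzW
  refine ⟨fun j => (⌊k * a j⌋₊ : ℕ) + d j, ?_, fun j => ?_⟩
  · rw [← hzm]
    congr 1
    have : z = W + ∑ j, (d j : ℝ) • X j := by rw [hd]; abel
    rw [this]
    simp [W, add_smul, Finset.sum_add_distrib]
  · have h1 := hfl j
    have h2 := hdM j
    have h3 := abs_add_le (((⌊k * a j⌋₊ : ℕ) : ℝ) - k * a j) (d j)
    push_cast
    rw [show ((⌊k * a j⌋₊ : ℕ) : ℝ) + (d j : ℝ) - k * a j =
      ((⌊k * a j⌋₊ : ℕ) : ℝ) - k * a j + d j by ring]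
    linarith

/-- If `X₁,…,X_m` are `η`-coplanar, then for every unit vector `θ` in the interior
of `C_X`, `γ(θ) = ⟨θ,η⟩ log Z(t) - ⟨t,θ⟩` where `t` is any solution of
`∇Z(t)/Z(t) = θ/⟨θ,η⟩`. -/
theorem stmt13 {s m : ℕ} (hs : 1 ≤ s) (hm : 2 ≤ m) (X : Fin m → Euc s)
    (hint : IntegralVecs X)
    (hspan : Submodule.span ℝ (Set.range X) = ⊤)
    (α : Euc s) (hα : ∀ j, 0 < ⟪X j, α⟫)
    (η : Euc s) (hη : ∀ j, ⟪η, X j⟫ = 1)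
    (θ : Euc s) (hθc : θ ∈ interior (coneOf X)) (hθ : ‖θ‖ = 1)
    (γθ : ℝ)
    (hγ : Filter.Tendsto (fun k : ℕ => Real.log (multC X ((k : ℝ) • θ)) / k)
      Filter.atTop (nhds γθ))
    (t : Euc s)
    (ht : (∑ j, Real.exp ⟪t, X j⟫ • X j)
        = (∑ j, Real.exp ⟪t, X j⟫) • ((⟪θ, η⟫)⁻¹ • θ)) :
    γθ = ⟪θ, η⟫ * Real.log (∑ j, Real.exp ⟪t, X j⟫) - ⟪t, θ⟫ := by
  classical
  -- positivity of `ℓ = ⟨θ, η⟩`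
  have hℓ : 0 < ⟪θ, η⟫ := by
    obtain ⟨c, hc, hcθ⟩ := interior_subset hθc
    have e : ⟪θ, η⟫ = ∑ j, c j := by
      rw [real_inner_comm, ← hcθ, inner_sum]
      simp [inner_smul_right, hη]
    have hnn : 0 ≤ ∑ j, c j := Finset.sum_nonneg fun j _ => hc j
    rw [e]
    refine lt_of_le_of_ne hnn fun h0 => ?_
    have h1 := (Finset.sum_eq_zero_iff_of_nonneg (fun j _ => hc j)).1 h0.symm
    have : θ = 0 := by
      rw [← hcθ]
      exact Finset.sum_eq_zero fun j hj => by rw [h1 j hj, zero_smul]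
    rw [this, norm_zero] at hθ
    exact zero_ne_one hθ
  set ℓ := ⟪θ, η⟫ with hℓdef
  set Z := ∑ j, Real.exp ⟪t, X j⟫ with hZdef
  have hZ : 0 < Z := by
    have : Nonempty (Fin m) := ⟨⟨0, by omega⟩⟩
    exact Finset.sum_pos (fun j _ => Real.exp_pos _) Finset.univ_nonempty
  let a : Fin m → ℝ := fun j => ℓ * (Real.exp ⟪t, X j⟫ / Z)
  have ha : ∀ j, 0 < a j := fun j => by positivity
  have haθ : ∑ j, a j • X j = θ := by
    have : ∑ j, a j • X j = (ℓ / Z) • ∑ j, Real.exp ⟪t, X j⟫ • X j := by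
      rw [Finset.smul_sum]
      refine Finset.sum_congr rfl fun j _ => ?_
      rw [smul_smul]; congr 1; simp only [a]; ring
    rw [this, ht, smul_smul, smul_smul]
    rw [show ℓ / Z * Z * ℓ⁻¹ = 1 by field_simp, one_smul]
  have hasum : ∑ j, a j = ℓ := by
    simp only [a]
    rw [← Finset.mul_sum, ← Finset.sum_div, ← hZdef, div_self hZ.ne', mul_one]
  have hat : ∑ j, a j * ⟪t, X j⟫ = ⟪t, θ⟫ := by
    rw [← haθ, inner_sum]
    simp [inner_smul_right]
  obtain ⟨M, hM⟩ := approx X hint a ha θ haθ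
  choose d hdm hdM using hM
  -- natural counts
  let u : ℕ → Fin m → ℕ := fun k j => (d k j).toNat
  have hdlim : ∀ j, Tendsto (fun k : ℕ => (d k j : ℝ) / k) atTop (𝓝 (a j)) := by
    intro j
    have hb : Tendsto (fun k : ℕ => M / (k : ℝ)) atTop (𝓝 0) :=
      tendsto_const_div_atTop_nhds_zero_nat M
    rw [tendsto_iff_dist_tendsto_zero]
    refine squeeze_zero' (Eventually.of_forall fun _ => dist_nonneg) ?_ hb
    filter_upwards [eventually_gt_atTop 0] with k hk
    have hk' : (0 : ℝ) < k := by exact_mod_cast hk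
    rw [Real.dist_eq, show (d k j : ℝ) / k - a j = ((d k j : ℝ) - k * a j) / k by field_simp,
      abs_div, abs_of_pos hk']
    exact div_le_div_of_nonneg_right (hdM k j) hk'.le
  have hud : ∀ᶠ k : ℕ in atTop, ∀ j, (u k j : ℝ) = d k j := by
    rw [eventually_all]
    intro j
    filter_upwards [(hdlim j).eventually (lt_mem_nhds (ha j)), eventually_gt_atTop 0] with k h hk
    have hk' : (0 : ℝ) < k := by exact_mod_cast hk
    have h1 : (0 : ℝ) < d k j := by
      by_contra hcon
      exact absurd h (not_lt.2 (div_nonpos_of_nonpos_of_nonneg (not_lt.1 hcon) hk'.le))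
    have h2 : 0 ≤ d k j := by exact_mod_cast h1.le
    simp only [u]
    exact_mod_cast Int.toNat_of_nonneg h2
  have hulim : ∀ j, Tendsto (fun k : ℕ => (u k j : ℝ) / k) atTop (𝓝 (a j)) := fun j =>
    (hdlim j).congr' (by filter_upwards [hud] with k hk; rw [hk j])
  let n : ℕ → ℕ := fun k => ∑ j, u k j
  have hnlim : Tendsto (fun k : ℕ => (n k : ℝ) / k) atTop (𝓝 ℓ) := by
    rw [← hasum]
    refine (tendsto_finsetSum _ fun j _ => hulim j).congr fun k => ?_
    simp only [n]
    rw [Nat.cast_sum, Finset.sum_div]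
  let z : ℕ → Euc s := fun k => ∑ j, (u k j : ℝ) • X j
  have hz : ∀ᶠ k : ℕ in atTop, mult X (z k) = multC X ((k : ℝ) • θ) := by
    filter_upwards [hud] with k hk
    rw [← hdm k]
    simp only [z, hk]
  have hzη : ∀ k, ⟪η, z k⟫ = n k := fun k => by
    simp only [z, n]
    rw [inner_sum]
    simp [inner_smul_right, hη]
  have hlow : ∀ k, ((n k).factorial : ℝ) ≤ mult X (z k) * ∏ j, ((u k j).factorial : ℝ) := fun k => by
    exact_mod_cast mult_lower X η hη (u k) (z k) rfl
  have hpos : ∀ k, (0 : ℝ) < mult X (z k) := fun k => by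
    have h1 : (0 : ℝ) < (n k).factorial := by positivity
    have h2 := h1.trans_le (hlow k)
    exact pos_of_mul_pos_left h2 (by positivity)
  have hγ' : Tendsto (fun k : ℕ => Real.log (mult X (z k)) / k) atTop (𝓝 γθ) :=
    hγ.congr' (by filter_upwards [hz] with k hk; rw [hk])
  apply le_antisymm
  · -- upper bound
    have hlim : Tendsto (fun k : ℕ => (n k : ℝ) / k * Real.log Z
        - ∑ j, (u k j : ℝ) / k * ⟪t, X j⟫) atTop (𝓝 (ℓ * Real.log Z - ⟪t, θ⟫)) := by
      rw [← hat]
      exact (hnlim.mul_const _).sub (tendsto_finsetSum _ fun j _ => (hulim j).mul_const _)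
    refine le_of_tendsto_of_tendsto hγ' hlim ?_
    filter_upwards [eventually_gt_atTop 0] with k hk
    have hk' : (0 : ℝ) < k := by exact_mod_cast hk
    have h := Real.log_le_log (mul_pos (hpos k) (Real.exp_pos _)) (mult_upper X η hη (z k) t (n k) (hzη k))
    rw [Real.log_mul (hpos k).ne' (Real.exp_pos _).ne', Real.log_exp, Real.log_pow, ← hZdef] at h
    have e : ⟪t, z k⟫ = ∑ j, (u k j : ℝ) * ⟪t, X j⟫ := by
      simp only [z]
      rw [inner_sum]
      simp [inner_smul_right]
    have e2 : ∑ j, (u k j : ℝ) / k * ⟪t, X j⟫ = ⟪t, z k⟫ / k := by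
      rw [e, Finset.sum_div]
      exact Finset.sum_congr rfl fun j _ => by ring
    rw [e2, div_mul_eq_mul_div, ← sub_div]
    exact div_le_div_of_nonneg_right (by linarith) hk'.le
  · -- lower bound
    have hlim := (log_fact_limit n ℓ hℓ hnlim).sub
      (tendsto_finsetSum Finset.univ fun j _ => log_fact_limit (fun k => u k j) (a j) (ha j) (hulim j))
    have e : ℓ * Real.log ℓ - ℓ - ∑ j, (a j * Real.log (a j) - a j)
        = ℓ * Real.log Z - ⟪t, θ⟫ := by
      have h1 : ∀ j, a j * Real.log (a j) - a j
          = a j * (Real.log ℓ - Real.log Z) + a j * ⟪t, X j⟫ - a j := fun j => by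
        have : Real.log (a j) = Real.log ℓ + (⟪t, X j⟫ - Real.log Z) := by
          simp only [a]
          rw [Real.log_mul hℓ.ne' (by positivity), Real.log_div (Real.exp_pos _).ne' hZ.ne',
            Real.log_exp]
        rw [this]; ring
      simp only [h1]
      rw [Finset.sum_sub_distrib, Finset.sum_add_distrib, ← Finset.sum_mul, hasum, hat]
      ring
    rw [e] at hlim
    refine le_of_tendsto_of_tendsto hlim hγ' ?_
    filter_upwards [eventually_gt_atTop 0] with k hk
    have hk' : (0 : ℝ) < k := by exact_mod_cast hk
    have h := Real.log_le_log (by positivity) (hlow k)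
    rw [Real.log_mul (hpos k).ne' (by positivity), Real.log_prod (fun j _ => by positivity)] at h
    rw [← Finset.sum_div, ← sub_div]
    refine div_le_div_of_nonneg_right ?_ hk'.le
    rw [Finset.sum_sub_distrib, ← Finset.sum_mul]
    have : (n k : ℝ) = ∑ j, (u k j : ℝ) := by simp only [n]; rw [Nat.cast_sum]
    rw [← this]
    linarith
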